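/- Let K, H, G be real Hilbert spaces, let L ∈ B(H,G) and S ∈ B(K,H) satisfy ‖L‖ ≤ 1, ‖S‖ ≤ 1, and L∘S ≠ 0, let g : G → (−∞,+∞] be proper with a continuous affine minorant, and let γ > 0. Then: (i) S ⊚_γ (L ⊚_γ g) = (L∘S) ⊚_γ g; (ii) S ⊙_γ (L ⊙_γ g) = (L∘S) ⊙_γ g. -/

import Mathlib

open scoped RealInnerProductSpace
open Filter Set

noncomputable section

/-- Fenchel (Legendre) conjugate of an extended-real-valued function. -/
def fconj {H : Type*} [NormedAddCommGroup H] [InnerProductSpace ℝ H]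
    (f : H → EReal) : H → EReal :=
  fun xs => ⨆ x : H, (⟪x, xs⟫ : EReal) - f x

/-- Moreau envelope of index `γ`. -/
def menv {H : Type*} [NormedAddCommGroup H] (γ : ℝ) (f : H → EReal) : H → EReal :=
  fun x => ⨅ y : H, f y + ((‖x - y‖ ^ 2 / (2 * γ) : ℝ) : EReal)

/-- Quadratic kernel `Q`. -/
def qk {H : Type*} [NormedAddCommGroup H] (x : H) : ℝ := ‖x‖ ^ 2 / 2

/-- Proximal composition `L ⊙_γ g`. -/
def proxComp {H G : Type*} [NormedAddCommGroup H] [InnerProductSpace ℝ H]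
    [NormedAddCommGroup G] [InnerProductSpace ℝ G]
    (L : H →L[ℝ] G) (γ : ℝ) (g : G → EReal) : H → EReal :=
  fun x => fconj (fun z => menv (1 / γ) (fconj g) (L z)) x - (((1 / γ) * qk x : ℝ) : EReal)

/-- Proximal cocomposition `L ⊚_γ g`. -/
def proxCocomp {H G : Type*} [NormedAddCommGroup H] [InnerProductSpace ℝ H]
    [NormedAddCommGroup G] [InnerProductSpace ℝ G]
    (L : H →L[ℝ] G) (γ : ℝ) (g : G → EReal) : H → EReal :=
  fconj (proxComp L (1 / γ) (fconj g))

/-- `f` is proper: not identically `+∞` and never `−∞`. -/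
def ProperE {H : Type*} (f : H → EReal) : Prop :=
  (∃ x, f x ≠ ⊤) ∧ ∀ x, f x ≠ ⊥

/-- `f` admits a continuous affine minorant. -/
def HasAffMinorant {H : Type*} [NormedAddCommGroup H] [InnerProductSpace ℝ H]
    (f : H → EReal) : Prop :=
  ∃ (u : H) (c : ℝ), ∀ x, ((⟪x, u⟫ + c : ℝ) : EReal) ≤ f x

/-- Convexity for extended-real-valued functions. -/
def ConvexE {H : Type*} [NormedAddCommGroup H] [InnerProductSpace ℝ H]
    (f : H → EReal) : Prop :=
  ∀ x y : H, ∀ a b : ℝ, 0 < a → 0 < b → a + b = 1 →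
    f (a • x + b • y) ≤ ((a : ℝ) : EReal) * f x + ((b : ℝ) : EReal) * f y

/-- The class `Γ₀`: proper, lower semicontinuous, convex. -/
def IsGamma0 {H : Type*} [NormedAddCommGroup H] [InnerProductSpace ℝ H]
    (f : H → EReal) : Prop :=
  ProperE f ∧ LowerSemicontinuous f ∧ ConvexE f

/-- `p` is a proximal point of `f` at `x`. -/
def IsProx {H : Type*} [NormedAddCommGroup H] (f : H → EReal) (x p : H) : Prop :=
  ∀ y : H, f p + ((‖x - p‖ ^ 2 / 2 : ℝ) : EReal) ≤ f y + ((‖x - y‖ ^ 2 / 2 : ℝ) : EReal)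

/-- Subdifferential. -/
def SubdiffE {H : Type*} [NormedAddCommGroup H] [InnerProductSpace ℝ H]
    (f : H → EReal) (x : H) : Set H :=
  {xs | ∀ y : H, (⟪y - x, xs⟫ : EReal) + f x ≤ f y}

/-- Recession function. -/
def recE {H : Type*} [NormedAddCommGroup H] (f : H → EReal) : H → EReal :=
  fun x => ⨆ y : {y : H // f y ≠ ⊤}, f (x + (y : H)) - f (y : H)

end

/-- `F` is real valued and, at every point, has an affine minorant touching it there which becomes
a majorant after adding `c / 2` times the squared distance. -/
def HasQuadSupport {H : Type*} [NormedAddCommGroup H] [InnerProductSpace ℝ H]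
    (c : ℝ) (F : H → EReal) : Prop :=
  ∀ x, ∃ (α : ℝ) (v : H), F x = α ∧ ∀ z,
    ((α + ⟪z - x, v⟫ : ℝ) : EReal) ≤ F z ∧
    F z ≤ ((α + ⟪z - x, v⟫ + c / 2 * ‖z - x‖ ^ 2 : ℝ) : EReal)

lemma EReal.coe_sub_le_comm {r : ℝ} {a b : EReal} (h : (r : EReal) - a ≤ b) :
    (r : EReal) - b ≤ a := by
  induction a <;> induction b <;> simp_all [← EReal.coe_sub] <;> linarith

lemma EReal.exists_coe_eq {a : EReal} (hb : a ≠ ⊥) (ht : a ≠ ⊤) : ∃ r : ℝ, a = r :=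
  ⟨a.toReal, (EReal.coe_toReal ht hb).symm⟩

section
variable {H G : Type*} [NormedAddCommGroup H] [InnerProductSpace ℝ H]
  [NormedAddCommGroup G] [InnerProductSpace ℝ G]

lemma coe_inner_sub_le_fconj (f : H → EReal) (x y : H) :
    (⟪x, y⟫ : EReal) - f x ≤ fconj f y :=
  le_iSup (fun x : H => (⟪x, y⟫ : EReal) - f x) x

lemma fconj_anti {f₁ f₂ : H → EReal} (h : ∀ x, f₁ x ≤ f₂ x) (y : H) :
    fconj f₂ y ≤ fconj f₁ y :=
  iSup_mono fun x => EReal.sub_le_sub le_rfl (h x)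

lemma fconj_fconj_le (f : H → EReal) (x : H) : fconj (fconj f) x ≤ f x := by
  refine iSup_le fun y => EReal.coe_sub_le_comm ?_
  rw [real_inner_comm]
  exact coe_inner_sub_le_fconj f x y

lemma fconj_fconj_fconj (f : H → EReal) : fconj (fconj (fconj f)) = fconj f :=
  funext fun y => le_antisymm (fconj_fconj_le _ y) (fconj_anti (fconj_fconj_le f) y)

lemma fconj_le_coe_iff {f : H → EReal} {y : H} {a : ℝ} :
    fconj f y ≤ a ↔ ∀ x, ((⟪x, y⟫ - a : ℝ) : EReal) ≤ f x := by
  simp only [fconj, iSup_le_iff, EReal.coe_sub]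
  exact forall_congr' fun x => ⟨EReal.coe_sub_le_comm, EReal.coe_sub_le_comm⟩

lemma ProperE.fconj {g : G → EReal} (hg : ProperE g) (hm : HasAffMinorant g) :
    ProperE (fconj g) := by
  obtain ⟨⟨x, hx⟩, hb⟩ := hg
  obtain ⟨u, c, hu⟩ := hm
  constructor
  · refine ⟨u, ne_top_of_le_ne_top (EReal.coe_ne_top (-c)) (fconj_le_coe_iff.2 fun x => ?_)⟩
    simpa using hu x
  · intro y
    obtain ⟨r, hr⟩ := EReal.exists_coe_eq (hb x) hx
    refine ne_bot_of_le_ne_bot (EReal.coe_ne_bot (⟪x, y⟫ - r)) ?_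
    rw [EReal.coe_sub, ← hr]
    exact coe_inner_sub_le_fconj g x y

lemma ProperE.hasAffMinorant_fconj {g : G → EReal} (hg : ProperE g) :
    HasAffMinorant (_root_.fconj g) := by
  obtain ⟨⟨x, hx⟩, hb⟩ := hg
  obtain ⟨r, hr⟩ := EReal.exists_coe_eq (hb x) hx
  refine ⟨x, -r, fun y => ?_⟩
  rw [← sub_eq_add_neg, EReal.coe_sub, ← hr, real_inner_comm]
  exact coe_inner_sub_le_fconj g x y

lemma setOf_fconj_le_eq (g : G → EReal) (hb : ∀ x, g x ≠ ⊥) :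
    {q : G × ℝ | fconj g q.1 ≤ q.2} =
      ⋂ (x : G) (_ : g x ≠ ⊤), {q : G × ℝ | ⟪x, q.1⟫ - q.2 ≤ (g x).toReal} := by
  ext q
  simp only [mem_ofPred_eq, fconj_le_coe_iff, mem_iInter]
  refine forall_congr' fun x => ⟨fun h ht => ?_, fun h => ?_⟩
  · rwa [← EReal.coe_le_coe_iff, EReal.coe_toReal ht (hb x)]
  · by_cases ht : g x = ⊤
    · simp [ht]
    · rw [← EReal.coe_toReal ht (hb x)]
      exact EReal.coe_le_coe_iff.2 (h ht)

lemma isClosed_setOf_fconj_le {g : G → EReal} (hb : ∀ x, g x ≠ ⊥) :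
    IsClosed {q : G × ℝ | fconj g q.1 ≤ q.2} := by
  rw [setOf_fconj_le_eq g hb]
  exact isClosed_iInter fun x => isClosed_iInter fun _ =>
    isClosed_le (by fun_prop) continuous_const

lemma convex_setOf_fconj_le {g : G → EReal} (hb : ∀ x, g x ≠ ⊥) :
    Convex ℝ {q : G × ℝ | fconj g q.1 ≤ q.2} := by
  rw [setOf_fconj_le_eq g hb]
  refine convex_iInter fun x => convex_iInter fun _ => ?_
  intro q hq q' hq' s t hs ht hst
  simp only [mem_ofPred_eq, Prod.fst_add, Prod.snd_add, Prod.smul_fst, Prod.smul_snd,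
    inner_add_right, inner_smul_right, smul_eq_mul] at *
  have : (g x).toReal = s * (g x).toReal + t * (g x).toReal := by rw [← add_mul, hst, one_mul]
  nlinarith [mul_le_mul_of_nonneg_left hq hs, mul_le_mul_of_nonneg_left hq' ht]

/-- A quadratic perturbation of the height function attains its minimum on a closed convex set. -/
lemma exists_forall_add_sq_le [CompleteSpace G] {C : Set (G × ℝ)} (hC : IsClosed C)
    (hconv : Convex ℝ C) (hne : C.Nonempty) {c : ℝ} (hc : 0 < c) (x : G) {B : ℝ}
    (hB : ∀ q ∈ C, B ≤ q.2 + c / 2 * ‖x - q.1‖ ^ 2) :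
    ∃ p ∈ C, ∀ q ∈ C, p.2 + c / 2 * ‖x - p.1‖ ^ 2 ≤ q.2 + c / 2 * ‖x - q.1‖ ^ 2 := by
  set V : G × ℝ → ℝ := fun q => q.2 + c / 2 * ‖x - q.1‖ ^ 2 with hV
  have hbdd : BddBelow (V '' C) := ⟨B, by rintro _ ⟨q, hq, rfl⟩; exact hB q hq⟩
  set m := sInf (V '' C) with hm
  have hmle : ∀ q ∈ C, m ≤ V q := fun q hq => csInf_le hbdd (mem_image_of_mem V hq)
  have hex : ∀ n : ℕ, ∃ q ∈ C, V q < m + 1 / ((n : ℝ) + 1) := fun n => by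
    obtain ⟨_, ⟨q, hq, rfl⟩, hlt⟩ := exists_lt_of_csInf_lt (hne.image V)
      (lt_add_of_pos_right m (Nat.one_div_pos_of_nat (n := n) (α := ℝ)))
    exact ⟨q, hq, hlt⟩
  choose u huC hu using hex
  have hzero : Tendsto (fun n : ℕ => 1 / ((n : ℝ) + 1)) atTop (nhds 0) :=
    tendsto_one_div_add_atTop_nhds_zero_nat
  have hVlim : Tendsto (fun n => V (u n)) atTop (nhds m) :=
    tendsto_of_tendsto_of_tendsto_of_le_of_le tendsto_const_nhds
      (by simpa using tendsto_const_nhds.add hzero) (fun n => hmle _ (huC n)) (fun n => (hu n).le)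
  have hmid : ∀ q ∈ C, ∀ q' ∈ C, c / 8 * ‖q.1 - q'.1‖ ^ 2 ≤ (V q + V q') / 2 - m := by
    intro q hq q' hq'
    have h1 := hmle _ (hconv hq hq' (by norm_num : (0 : ℝ) ≤ 1 / 2)
      (by norm_num : (0 : ℝ) ≤ 1 / 2) (by norm_num))
    have h2 := parallelogram_law_with_norm ℝ (x - q.1) (x - q'.1)
    have e1 : x - ((1 / 2 : ℝ) • q.1 + (1 / 2 : ℝ) • q'.1)
        = (1 / 2 : ℝ) • ((x - q.1) + (x - q'.1)) := by module
    have e2 : (x - q.1) - (x - q'.1) = -(q.1 - q'.1) := by abel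
    rw [e2, norm_neg] at h2
    simp only [hV, Prod.fst_add, Prod.snd_add, Prod.smul_fst, Prod.smul_snd, smul_eq_mul] at h1 ⊢
    rw [e1, norm_smul, mul_pow] at h1
    norm_num at h1
    linear_combination h1 + c / 8 * h2
  have hcauchy : CauchySeq fun n => (u n).1 := by
    refine cauchySeq_of_le_tendsto_0 (fun n : ℕ => √(8 / c * (1 / ((n : ℝ) + 1)))) ?_ ?_
    · intro n k N hn hk
      rw [dist_eq_norm]
      refine Real.le_sqrt_of_sq_le ?_
      have h1 := hmid _ (huC n) _ (huC k)
      have h2 := Nat.one_div_le_one_div (α := ℝ) hn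
      have h3 := Nat.one_div_le_one_div (α := ℝ) hk
      have h4 : c / 8 * ‖(u n).1 - (u k).1‖ ^ 2 ≤ 1 / ((N : ℝ) + 1) := by
        linarith [hu n, hu k]
      calc ‖(u n).1 - (u k).1‖ ^ 2 = 8 / c * (c / 8 * ‖(u n).1 - (u k).1‖ ^ 2) := by field_simp
        _ ≤ _ := by gcongr
    · simpa using (hzero.const_mul (8 / c)).sqrt
  obtain ⟨p, hp⟩ := cauchySeq_tendsto_of_complete hcauchy
  have hsnd : Tendsto (fun n => (u n).2) atTop (nhds (m - c / 2 * ‖x - p‖ ^ 2)) := by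
    have h := hVlim.sub ((((tendsto_const_nhds (x := x)).sub hp).norm.pow 2).const_mul (c / 2))
    simpa [hV] using h
  refine ⟨(p, m - c / 2 * ‖x - p‖ ^ 2),
    hC.mem_of_tendsto (hp.prodMk_nhds hsnd) (Eventually.of_forall huC), fun q hq => ?_⟩
  simpa using hmle q hq

lemma add_inner_le_of_forall_add_sq_le {C : Set (G × ℝ)} (hconv : Convex ℝ C)
    {c : ℝ} (hc : 0 < c) {x : G} {p q : G × ℝ} (hp : p ∈ C) (hq : q ∈ C)
    (hmin : ∀ q ∈ C, p.2 + c / 2 * ‖x - p.1‖ ^ 2 ≤ q.2 + c / 2 * ‖x - q.1‖ ^ 2) :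
    p.2 + c * ⟪x - p.1, q.1 - p.1⟫ ≤ q.2 := by
  by_contra! hlt
  set e := q.1 - p.1 with he
  set δ := p.2 + c * ⟪x - p.1, e⟫ - q.2 with hδ
  have hδ0 : 0 < δ := by linarith
  have hD : 0 < δ + c * ‖e‖ ^ 2 := by positivity
  set t := δ / (δ + c * ‖e‖ ^ 2) with ht
  have ht0 : 0 < t := by positivity
  have ht1 : t ≤ 1 := (div_le_one hD).2 (by nlinarith [sq_nonneg ‖e‖])
  have htD : t * (δ + c * ‖e‖ ^ 2) = δ := div_mul_cancel₀ _ hD.ne'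
  have h := hmin _ (hconv hp hq (sub_nonneg.2 ht1) ht0.le (by ring))
  have e1 : x - ((1 - t) • p.1 + t • q.1) = (x - p.1) - t • e := by rw [he]; module
  simp only [Prod.fst_add, Prod.snd_add, Prod.smul_fst, Prod.smul_snd, smul_eq_mul] at h
  rw [e1, norm_sub_sq_real (x - p.1), norm_smul, inner_smul_right, mul_pow, Real.norm_eq_abs, sq_abs] at h
  have h1 : t * δ ≤ t * (t * (c * ‖e‖ ^ 2 / 2)) := by rw [hδ]; linarith
  have h2 := le_of_mul_le_mul_left h1 ht0
  nlinarith [mul_pos ht0 hδ0]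

lemma inner_add_sq_lower_bound {c : ℝ} (hc : 0 < c) (v w : G) :
    -(‖v‖ ^ 2 / (2 * c)) ≤ ⟪w, v⟫ + c / 2 * ‖w‖ ^ 2 := by
  have h1 : 0 ≤ ‖v + c • w‖ ^ 2 / (2 * c) := by positivity
  rw [norm_add_sq_real, norm_smul, inner_smul_right, Real.norm_of_nonneg hc.le,
    real_inner_comm] at h1
  have h2 : (‖v‖ ^ 2 + 2 * (c * ⟪w, v⟫) + (c * ‖w‖) ^ 2) / (2 * c)
      = ‖v‖ ^ 2 / (2 * c) + (⟪w, v⟫ + c / 2 * ‖w‖ ^ 2) := by field_simp; ring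
  linarith

lemma hasQuadSupport_menv_fconj [CompleteSpace G] {g : G → EReal} (hg : ProperE g)
    (hm : HasAffMinorant g) {c : ℝ} (hc : 0 < c) :
    HasQuadSupport c (menv (1 / c) (fconj g)) := by
  intro x
  have hpr := hg.fconj hm
  obtain ⟨u, r, hur⟩ := hg.hasAffMinorant_fconj
  obtain ⟨y₀, hy₀⟩ := hpr.1
  have hsq : ∀ y z : G, ‖z - y‖ ^ 2 / (2 * (1 / c)) = c / 2 * ‖z - y‖ ^ 2 := fun y z => by
    field_simp
  obtain ⟨p, hpC, hp⟩ := exists_forall_add_sq_le (isClosed_setOf_fconj_le hg.2)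
    (convex_setOf_fconj_le hg.2)
    ⟨(y₀, (fconj g y₀).toReal), EReal.le_coe_toReal hy₀⟩ hc x
    (B := ⟪x, u⟫ + r - ‖u‖ ^ 2 / (2 * c)) (fun q hq => by
      have h1 := EReal.coe_le_coe_iff.1 ((hur q.1).trans hq)
      have h2 := inner_add_sq_lower_bound hc u (q.1 - x)
      rw [inner_sub_left, norm_sub_rev] at h2
      linarith)
  have hopt : ∀ y b, fconj g y ≤ (b : ℝ) → p.2 + c * ⟪x - p.1, y - p.1⟫ ≤ b := fun y b hy =>
    add_inner_le_of_forall_add_sq_le (q := (y, b)) (convex_setOf_fconj_le hg.2) hc hpC hy hp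
  have hupper : ∀ z, menv (1 / c) (fconj g) z ≤ ((p.2 + c / 2 * ‖z - p.1‖ ^ 2 : ℝ) : EReal) := by
    intro z
    refine (iInf_le _ p.1).trans ?_
    rw [hsq, EReal.coe_add]
    gcongr
    exact hpC
  have hlower : ∀ z, ((p.2 + c / 2 * ‖x - p.1‖ ^ 2 + ⟪z - x, c • (x - p.1)⟫ : ℝ) : EReal)
      ≤ menv (1 / c) (fconj g) z := by
    intro z
    refine le_iInf fun y => ?_
    rw [hsq]
    by_cases hy : fconj g y = ⊤
    · rw [hy, EReal.top_add_coe]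
      exact le_top
    obtain ⟨b, hb⟩ := EReal.exists_coe_eq (hpr.2 y) hy
    rw [hb, ← EReal.coe_add, EReal.coe_le_coe_iff]
    have h1 := hopt y b hb.le
    have h2 : 0 ≤ c / 2 * ‖(z - y) - (x - p.1)‖ ^ 2 := by positivity
    have h3 : y - p.1 = (z - x) - (z - y) + (x - p.1) := by abel
    rw [norm_sub_sq_real] at h2
    rw [h3, inner_add_right, inner_sub_right, real_inner_self_eq_norm_sq,
      real_inner_comm (z - x), real_inner_comm (z - y)] at h1
    rw [inner_smul_right]
    linarith
  refine ⟨p.2 + c / 2 * ‖x - p.1‖ ^ 2, c • (x - p.1), le_antisymm (hupper x)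
    (by simpa using hlower x), fun z => ⟨hlower z, (hupper z).trans_eq ?_⟩⟩
  have h3 : z - p.1 = (z - x) + (x - p.1) := by abel
  rw [h3, norm_add_sq_real, inner_smul_right]
  congr 1
  ring

lemma HasQuadSupport.comp [CompleteSpace H] [CompleteSpace G] {c : ℝ} (hc : 0 ≤ c)
    {F : G → EReal} (hF : HasQuadSupport c F) {L : H →L[ℝ] G} (hL : ‖L‖ ≤ 1) :
    HasQuadSupport c fun z => F (L z) := by
  intro x
  obtain ⟨α, v, hα, h⟩ := hF (L x)
  refine ⟨α, L.adjoint v, hα, fun z => ?_⟩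
  rw [ContinuousLinearMap.adjoint_inner_right, map_sub]
  refine ⟨(h (L z)).1, (h (L z)).2.trans (EReal.coe_le_coe_iff.2 ?_)⟩
  have : ‖L z - L x‖ ≤ ‖z - x‖ := by
    rw [← map_sub]
    exact (L.le_of_opNorm_le hL _).trans_eq (one_mul _)
  gcongr

/-- Subtracting the quadratic kernel from the conjugate is undone by the Moreau envelope of the
conjugate. -/
lemma HasQuadSupport.menv_fconj_sub {c : ℝ} (hc : 0 < c) {F : H → EReal}
    (hF : HasQuadSupport c F) :
    menv (1 / c) (fconj fun w => fconj F w - ((1 / c * qk w : ℝ) : EReal)) = F := by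
  funext x
  obtain ⟨α, v, hα, h⟩ := hF x
  have hsq : ∀ y z : H, ‖z - y‖ ^ 2 / (2 * (1 / c)) = c / 2 * ‖z - y‖ ^ 2 := fun y z => by
    field_simp
  have hge : ∀ w, ((⟪w, x⟫ - α + ‖w - v‖ ^ 2 / (2 * c) : ℝ) : EReal) ≤ fconj F w := by
    intro w
    refine le_trans ?_ (coe_inner_sub_le_fconj F (x + c⁻¹ • (w - v)) w)
    refine le_trans ?_ (EReal.sub_le_sub le_rfl (h _).2)
    rw [← EReal.coe_sub, EReal.coe_le_coe_iff, add_sub_cancel_left, norm_smul, inner_add_left,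
      inner_smul_left, inner_smul_left, Real.norm_of_nonneg (inv_nonneg.2 hc.le), real_inner_comm]
    have h1 : ⟪w - v, w⟫ = ‖w - v‖ ^ 2 + ⟪w - v, v⟫ := by
      rw [← real_inner_self_eq_norm_sq, ← inner_add_right, sub_add_cancel]
    rw [h1]
    apply le_of_eq
    simp only [conj_trivial]
    field_simp
    ring
  have hle : fconj F v ≤ ((⟪x, v⟫ - α : ℝ) : EReal) := by
    refine fconj_le_coe_iff.2 fun z => le_trans (EReal.coe_le_coe_iff.2 ?_) (h z).1
    rw [inner_sub_left]
    linarith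
  rw [hα]
  apply le_antisymm
  · refine (iInf_le _ (x - c⁻¹ • v)).trans ?_
    rw [hsq, sub_sub_cancel]
    have : fconj (fun w => fconj F w - ((1 / c * qk w : ℝ) : EReal)) (x - c⁻¹ • v)
        ≤ ((α - c / 2 * ‖c⁻¹ • v‖ ^ 2 : ℝ) : EReal) := by
      refine fconj_le_coe_iff.2 fun w => ?_
      refine le_trans ?_ (EReal.sub_le_sub (hge w) le_rfl)
      rw [← EReal.coe_sub, EReal.coe_le_coe_iff, norm_smul, inner_sub_right, inner_smul_right,
        Real.norm_of_nonneg (inv_nonneg.2 hc.le), qk, norm_sub_sq_real]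
      apply le_of_eq
      field_simp
      ring
    refine (add_le_add_left this _).trans_eq ?_
    rw [← EReal.coe_add, sub_add_cancel]
  · refine le_iInf fun y => ?_
    rw [hsq]
    have h1 : ((⟪v, y⟫ - (⟪x, v⟫ - α - 1 / c * qk v) : ℝ) : EReal)
        ≤ fconj (fun w => fconj F w - ((1 / c * qk w : ℝ) : EReal)) y := by
      refine le_trans ?_ (coe_inner_sub_le_fconj _ v y)
      rw [EReal.coe_sub, EReal.coe_sub]
      exact EReal.sub_le_sub le_rfl (EReal.sub_le_sub hle le_rfl)
    refine le_trans ?_ (add_le_add_left h1 _)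
    rw [← EReal.coe_add, EReal.coe_le_coe_iff, qk]
    have h2 := inner_add_sq_lower_bound hc v (y - x)
    rw [inner_sub_left, norm_sub_rev, real_inner_comm] at h2
    have h3 : 1 / c * (‖v‖ ^ 2 / 2) = ‖v‖ ^ 2 / (2 * c) := by field_simp
    linarith

lemma menv_fconj_proxComp [CompleteSpace H] [CompleteSpace G] {L : H →L[ℝ] G} (hL : ‖L‖ ≤ 1)
    {g : G → EReal} (hg : ProperE g) (hm : HasAffMinorant g) {γ : ℝ} (hγ : 0 < γ) :
    menv (1 / γ) (fconj (proxComp L γ g)) = fun z => menv (1 / γ) (fconj g) (L z) :=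
  ((hasQuadSupport_menv_fconj hg hm hγ).comp hγ.le hL).menv_fconj_sub hγ

lemma proxComp_fconj_fconj (L : H →L[ℝ] G) (γ : ℝ) (g : G → EReal) :
    proxComp L γ (fconj (fconj g)) = proxComp L γ g := by
  funext x
  rw [proxComp, fconj_fconj_fconj, proxComp]

lemma proxComp_proxComp {K : Type*} [NormedAddCommGroup K] [InnerProductSpace ℝ K]
    [CompleteSpace H] [CompleteSpace G] {L : H →L[ℝ] G} (S : K →L[ℝ] H) (hL : ‖L‖ ≤ 1)
    {g : G → EReal} (hg : ProperE g) (hm : HasAffMinorant g) {γ : ℝ} (hγ : 0 < γ) :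
    proxComp S γ (proxComp L γ g) = proxComp (L.comp S) γ g := by
  funext x
  rw [proxComp, menv_fconj_proxComp hL hg hm hγ]
  rfl

end

/-- Composition rules: `S ⊚_γ (L ⊚_γ g) = (L∘S) ⊚_γ g` and
`S ⊙_γ (L ⊙_γ g) = (L∘S) ⊙_γ g`. -/
theorem proxComp_proxCocomp_comp
    {K H G : Type*} [NormedAddCommGroup K] [InnerProductSpace ℝ K] [CompleteSpace K]
    [NormedAddCommGroup H] [InnerProductSpace ℝ H] [CompleteSpace H]
    [NormedAddCommGroup G] [InnerProductSpace ℝ G] [CompleteSpace G]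
    (L : H →L[ℝ] G) (S : K →L[ℝ] H) (hL : ‖L‖ ≤ 1) (hS : ‖S‖ ≤ 1)
    (hLS : L.comp S ≠ 0)
    (g : G → EReal) (hg : ProperE g) (hm : HasAffMinorant g)
    (γ : ℝ) (hγ : 0 < γ) :
    proxCocomp S γ (proxCocomp L γ g) = proxCocomp (L.comp S) γ g ∧
    proxComp S γ (proxComp L γ g) = proxComp (L.comp S) γ g := by
  refine ⟨?_, proxComp_proxComp S hL hg hm hγ⟩
  simp only [proxCocomp]
  rw [proxComp_fconj_fconj,
    proxComp_proxComp S hL (hg.fconj hm) hg.hasAffMinorant_fconj (one_div_pos.2 hγ)]
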